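/- For all a, b, c, a′, b′, c′ ∈ ℂ with 4a³ + 1 = 0, 4b³ + 10 = 0, 4c³ + 100 = 0, 4a′³ + 1 = 0, 4b′³ + 10 = 0 and 4c′³ + 100 = 0: if a + 10b + 100c = a′ + 10b′ + 100c′, then (a, b, c) = (a′, b′, c′). -/

import Mathlib

/-- Distinct cube roots of the same number are at distance `√3` times their modulus; in
particular, two of them at distance less than their modulus coincide. -/
theorem eq_of_pow_three_eq_of_norm_sub_lt {x y : ℂ} {r : ℝ} (h : x ^ 3 = y ^ 3)
    (hx : r ≤ ‖x‖) (hy : r ≤ ‖y‖) (hxy : ‖x - y‖ < r) : x = y := by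
  by_contra hne
  have hq : x ^ 2 + x * y + y ^ 2 = 0 :=
    mul_left_cancel₀ (sub_ne_zero.mpr hne) (by linear_combination h)
  have hsq : (x - y) ^ 2 = -(3 * (x * y)) := by linear_combination hq
  have hnorm : ‖x - y‖ ^ 2 = 3 * (‖x‖ * ‖y‖) := by
    rw [← norm_pow, hsq, norm_neg, norm_mul, norm_mul, Complex.norm_ofNat]
  have h0 := norm_nonneg (x - y)
  have hr : r * r ≤ ‖x‖ * ‖y‖ := mul_le_mul hx hy (by linarith) (norm_nonneg x)
  nlinarith

theorem norm_pow_three_of_four_mul_add {x : ℂ} {k : ℝ} (hk : 0 ≤ k)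
    (h : 4 * x ^ 3 + k = 0) : ‖x‖ ^ 3 = k / 4 := by
  have hx : x ^ 3 = -((k / 4 : ℝ) : ℂ) := by
    push_cast
    linear_combination h / 4
  rw [← norm_pow, hx, norm_neg, Complex.norm_of_nonneg (by positivity)]

/-- The linear form `a + 10b + 100c` takes distinct values on distinct
triples of cube roots `(a, b, c)` with `a³ = -1/4`, `b³ = -5/2`, `c³ = -25`. -/
theorem stmt_13 (a b c a' b' c' : ℂ)
    (ha : 4 * a ^ 3 + 1 = 0) (hb : 4 * b ^ 3 + 10 = 0) (hc : 4 * c ^ 3 + 100 = 0)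
    (ha' : 4 * a' ^ 3 + 1 = 0) (hb' : 4 * b' ^ 3 + 10 = 0) (hc' : 4 * c' ^ 3 + 100 = 0)
    (heq : a + 10 * b + 100 * c = a' + 10 * b' + 100 * c') :
    a = a' ∧ b = b' ∧ c = c' := by
  have norm_a_le {x : ℂ} (h : 4 * x ^ 3 + 1 = 0) : ‖x‖ ≤ 7 / 10 := by
    have := norm_pow_three_of_four_mul_add (k := 1) (by norm_num) (by exact_mod_cast h)
    exact le_of_pow_le_pow_left₀ three_ne_zero (by norm_num) (by rw [this]; norm_num)
  have norm_b_le {x : ℂ} (h : 4 * x ^ 3 + 10 = 0) : ‖x‖ ≤ 7 / 5 := by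
    have := norm_pow_three_of_four_mul_add (k := 10) (by norm_num) (by exact_mod_cast h)
    exact le_of_pow_le_pow_left₀ three_ne_zero (by norm_num) (by rw [this]; norm_num)
  have le_norm_b {x : ℂ} (h : 4 * x ^ 3 + 10 = 0) : 1 ≤ ‖x‖ := by
    have := norm_pow_three_of_four_mul_add (k := 10) (by norm_num) (by exact_mod_cast h)
    exact le_of_pow_le_pow_left₀ three_ne_zero (norm_nonneg x) (by rw [this]; norm_num)
  have le_norm_c {x : ℂ} (h : 4 * x ^ 3 + 100 = 0) : 2 ≤ ‖x‖ := by
    have := norm_pow_three_of_four_mul_add (k := 100) (by norm_num) (by exact_mod_cast h)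
    exact le_of_pow_le_pow_left₀ three_ne_zero (norm_nonneg x) (by rw [this]; norm_num)
  have hA : ‖a' - a‖ ≤ 7 / 5 := by
    linarith [norm_sub_le a' a, norm_a_le ha, norm_a_le ha']
  have hB : ‖b' - b‖ ≤ 14 / 5 := by
    linarith [norm_sub_le b' b, norm_b_le hb, norm_b_le hb']
  have hcc : c = c' := by
    refine eq_of_pow_three_eq_of_norm_sub_lt (by linear_combination (hc - hc') / 4)
      (le_norm_c hc) (le_norm_c hc') ?_
    have hsub : 100 * (c - c') = (a' - a) + 10 * (b' - b) := by linear_combination heq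
    have hle := norm_add_le (a' - a) (10 * (b' - b))
    rw [← hsub, norm_mul, norm_mul, Complex.norm_ofNat, Complex.norm_ofNat] at hle
    linarith
  subst hcc
  have hbb : b = b' := by
    refine eq_of_pow_three_eq_of_norm_sub_lt (by linear_combination (hb - hb') / 4)
      (le_norm_b hb) (le_norm_b hb') ?_
    have hsub : 10 * (b - b') = a' - a := by linear_combination heq
    rw [← hsub, norm_mul, Complex.norm_ofNat] at hA
    linarith
  subst hbb
  exact ⟨by linear_combination heq, rfl, rfl⟩
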